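/- Let M and L be c-utility act sets on K. Then the function p ↦ h_M(p) − h_L(p) is convex on Δ(K) if and only if there exists a c-utility act set T on K such that M = L + T (Minkowski sum of sets). -/

import Mathlib

open MeasureTheory Pointwise

/-- The pairing `⟨p, x⟩ = ∑ k, p k * x k`. -/
def pairing {K : Type} [Fintype K] (p x : K → ℝ) : ℝ := ∑ k, p k * x k

/-- The simplex of beliefs `Δ(K)`. -/
def simplexSet (K : Type) [Fintype K] : Set (K → ℝ) :=
  {p | (∀ k, 0 ≤ p k) ∧ ∑ k, p k = 1}

/-- The negative orthant `ℝ₋^K`. -/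
def negOrthant (K : Type) [Fintype K] : Set (K → ℝ) := {v | ∀ k, v k ≤ 0}

/-- The restricted support function `h_G`. -/
noncomputable def suppFn {K : Type} [Fintype K] (G : Set (K → ℝ)) (p : K → ℝ) : ℝ :=
  sSup ((fun g => pairing p g) '' G)

/-- A c-utility act set: nonempty, closed, convex, comprehensive, with
`{⟨p, g⟩ : g ∈ G}` bounded above for each belief `p`, and `h_G` continuous on the simplex. -/
def IsCUAS {K : Type} [Fintype K] (G : Set (K → ℝ)) : Prop :=
  G.Nonempty ∧ IsClosed G ∧ Convex ℝ G ∧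
  (∀ g ∈ G, ∀ v ∈ negOrthant K, g + v ∈ G) ∧
  (∀ p ∈ simplexSet K, BddAbove ((fun g => pairing p g) '' G)) ∧
  ContinuousOn (suppFn G) (simplexSet K)

/-- The value of information of information structure `q` for decision maker `G`. -/
noncomputable def VoI {K : Type} [Fintype K] (G : Set (K → ℝ)) {Ω : Type}
    [MeasurableSpace Ω] (ℙ : Measure Ω) (q : Ω → K → ℝ) : ℝ :=
  (∫ ω, suppFn G (q ω) ∂ℙ) - suppFn G (∫ ω, q ω ∂ℙ)

section SupportFunctions

variable {K : Type} [Fintype K]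

lemma pairing_add (p x y : K → ℝ) : pairing p (x + y) = pairing p x + pairing p y := by
  simp [pairing, mul_add, Finset.sum_add_distrib]

lemma pairing_smul (p : K → ℝ) (c : ℝ) (x : K → ℝ) : pairing p (c • x) = c * pairing p x := by
  simp only [pairing, Pi.smul_apply, smul_eq_mul, Finset.mul_sum]
  exact Finset.sum_congr rfl fun k _ => by ring

lemma pairing_add_left (p q x : K → ℝ) : pairing (p + q) x = pairing p x + pairing q x := by
  simp [pairing, add_mul, Finset.sum_add_distrib]

lemma pairing_smul_left (c : ℝ) (p x : K → ℝ) : pairing (c • p) x = c * pairing p x := by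
  simp only [pairing, Pi.smul_apply, smul_eq_mul, Finset.mul_sum, mul_assoc]

lemma continuous_pairing (p : K → ℝ) : Continuous (pairing p) := by
  unfold pairing
  fun_prop

lemma pairing_nonpos {p v : K → ℝ} (hp : p ∈ simplexSet K) (hv : v ∈ negOrthant K) :
    pairing p v ≤ 0 :=
  Finset.sum_nonpos fun k _ => mul_nonpos_of_nonneg_of_nonpos (hp.1 k) (hv k)

lemma pairing_const {p : K → ℝ} (hp : p ∈ simplexSet K) (c : ℝ) :
    pairing p (fun _ => c) = c := by
  simp [pairing, ← Finset.sum_mul, hp.2]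

lemma exists_pairing_eq (φ : (K → ℝ) →L[ℝ] ℝ) : ∃ a : K → ℝ, ∀ x, φ x = pairing a x := by
  classical
  refine ⟨fun k => φ (Pi.single k 1), fun x => ?_⟩
  rw [← ContinuousLinearMap.coe_coe, LinearMap.pi_apply_eq_sum_univ]
  refine Finset.sum_congr rfl fun k _ => ?_
  rw [smul_eq_mul, mul_comm]
  congr 2
  ext j
  simp [Pi.single_apply, eq_comm]

lemma isClosed_simplexSet : IsClosed (simplexSet K) := by
  simp only [simplexSet, Set.ofPred_and, Set.ofPred_forall]
  exact (isClosed_iInter fun k => isClosed_le continuous_const (continuous_apply k)).inter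
    (isClosed_eq (by fun_prop) continuous_const)

lemma convex_simplexSet : Convex ℝ (simplexSet K) := by
  rintro p ⟨hp, hp'⟩ q ⟨hq, hq'⟩ a b ha hb hab
  refine ⟨fun k => add_nonneg (mul_nonneg ha (hp k)) (mul_nonneg hb (hq k)), ?_⟩
  simp [Finset.sum_add_distrib, ← Finset.mul_sum, hp', hq', hab]

lemma single_mem_simplexSet [DecidableEq K] (k : K) : Pi.single k 1 ∈ simplexSet K := by
  refine ⟨fun j => ?_, by simp⟩
  rw [Pi.single_apply]
  split_ifs <;> norm_num

lemma pairing_single [DecidableEq K] (k : K) (x : K → ℝ) : pairing (Pi.single k 1) x = x k := by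
  simp [pairing, Pi.single_apply]

lemma pairing_le_suppFn {G : Set (K → ℝ)} {p g : K → ℝ}
    (hG : BddAbove ((fun g => pairing p g) '' G)) (hg : g ∈ G) : pairing p g ≤ suppFn G p :=
  le_csSup hG (Set.mem_image_of_mem _ hg)

lemma suppFn_le {G : Set (K → ℝ)} (hG : G.Nonempty) {p : K → ℝ} {c : ℝ}
    (h : ∀ g ∈ G, pairing p g ≤ c) : suppFn G p ≤ c :=
  csSup_le (hG.image _) (Set.forall_mem_image.2 h)

lemma suppFn_add {G H : Set (K → ℝ)} (hG : G.Nonempty) (hH : H.Nonempty) {p : K → ℝ}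
    (hGb : BddAbove ((fun g => pairing p g) '' G)) (hHb : BddAbove ((fun g => pairing p g) '' H)) :
    suppFn (G + H) p = suppFn G p + suppFn H p := by
  unfold suppFn
  rw [← csSup_add (hG.image _) hGb (hH.image _) hHb]
  congr 1
  ext r
  simp only [Set.mem_image, Set.mem_add]
  constructor
  · rintro ⟨_, ⟨g, hg, h, hh, rfl⟩, rfl⟩
    exact ⟨_, ⟨g, hg, rfl⟩, _, ⟨h, hh, rfl⟩, (pairing_add p g h).symm⟩
  · rintro ⟨_, ⟨g, hg, rfl⟩, _, ⟨h, hh, rfl⟩, rfl⟩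
    exact ⟨_, ⟨g, hg, h, hh, rfl⟩, pairing_add p g h⟩

lemma convexOn_suppFn {G : Set (K → ℝ)} (hG : G.Nonempty)
    (hb : ∀ p ∈ simplexSet K, BddAbove ((fun g => pairing p g) '' G)) :
    ConvexOn ℝ (simplexSet K) (suppFn G) := by
  refine ⟨convex_simplexSet, fun p hp q hq a b ha hb' _ => suppFn_le hG fun g hg => ?_⟩
  rw [pairing_add_left, pairing_smul_left, pairing_smul_left, smul_eq_mul, smul_eq_mul]
  exact add_le_add (mul_le_mul_of_nonneg_left (pairing_le_suppFn (hb p hp) hg) ha)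
    (mul_le_mul_of_nonneg_left (pairing_le_suppFn (hb q hq) hg) hb')

/-- A nonempty closed convex comprehensive set contains every point that satisfies all the
inequalities given by its support function on the simplex. -/
lemma mem_of_forall_pairing_le {G : Set (K → ℝ)} (hne : G.Nonempty) (hcl : IsClosed G)
    (hcv : Convex ℝ G) (hcomp : ∀ g ∈ G, ∀ v ∈ negOrthant K, g + v ∈ G) {x : K → ℝ}
    (hx : ∀ p ∈ simplexSet K, pairing p x ≤ suppFn G p) : x ∈ G := by
  classical
  by_contra hxG
  obtain ⟨φ, u, hφ, hu⟩ := geometric_hahn_banach_closed_point hcv hcl hxG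
  obtain ⟨a, ha⟩ := exists_pairing_eq φ
  simp only [ha] at hφ hu
  obtain ⟨g, hg⟩ := hne
  have ha0 : ∀ k, 0 ≤ a k := by
    intro k
    by_contra! hk
    set c : ℝ := (u - pairing a g) / a k with hc
    have hc0 : c ≤ 0 := div_nonpos_of_nonneg_of_nonpos (by linarith [hφ g hg]) hk.le
    have h := hφ _ (hcomp g hg (c • Pi.single k 1) fun j => by
      simp only [Pi.smul_apply, smul_eq_mul]
      exact mul_nonpos_of_nonpos_of_nonneg hc0 ((single_mem_simplexSet k).1 j))
    have h1 : pairing a (Pi.single k 1) = a k := by simp [pairing, Pi.single_apply]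
    rw [pairing_add, pairing_smul, h1, hc, div_mul_cancel₀ _ hk.ne] at h
    linarith
  have hs : 0 < ∑ k, a k := by
    refine (Finset.sum_nonneg fun k _ => ha0 k).lt_of_ne fun h => ?_
    have ha' : a = 0 := funext fun k =>
      (Finset.sum_eq_zero_iff_of_nonneg fun k _ => ha0 k).1 h.symm k (Finset.mem_univ k)
    have h1 := hφ g hg
    simp only [ha', pairing, Pi.zero_apply, zero_mul, Finset.sum_const_zero] at h1 hu
    linarith
  set s := ∑ k, a k
  have hp : s⁻¹ • a ∈ simplexSet K := by
    refine ⟨fun k => mul_nonneg (inv_nonneg.2 hs.le) (ha0 k), ?_⟩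
    simp only [Pi.smul_apply, smul_eq_mul, ← Finset.mul_sum]
    exact inv_mul_cancel₀ hs.ne'
  have h1 := hx _ hp
  have h2 : suppFn G (s⁻¹ • a) ≤ s⁻¹ * u := suppFn_le ⟨g, hg⟩ fun g hg => by
    rw [pairing_smul_left]
    exact mul_le_mul_of_nonneg_left (hφ g hg).le (inv_nonneg.2 hs.le)
  rw [pairing_smul_left] at h1
  exact absurd (h1.trans h2) (not_le.2 (mul_lt_mul_of_pos_left hu (inv_pos.2 hs)))

/-- A continuous convex function on the simplex is the supremum of its linear minorants. -/
lemma exists_pairing_eq_of_lt {f : (K → ℝ) → ℝ} (hf : ConvexOn ℝ (simplexSet K) f)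
    (hc : ContinuousOn f (simplexSet K)) {p : K → ℝ} (hp : p ∈ simplexSet K) {r : ℝ}
    (hr : r < f p) : ∃ x : K → ℝ, (∀ q ∈ simplexSet K, pairing q x ≤ f q) ∧ pairing p x = r := by
  have hcl := IsClosed.epigraph isClosed_simplexSet hc
  obtain ⟨φ, u, hu, hφ⟩ := geometric_hahn_banach_point_closed hf.convex_epigraph hcl
    (x := (p, r)) fun h => absurd h.2 (not_le.2 hr)
  obtain ⟨a, ha⟩ := exists_pairing_eq (φ.comp (ContinuousLinearMap.inl ℝ (K → ℝ) ℝ))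
  set b := φ (0, 1) with hb
  have hφ' : ∀ q s, φ (q, s) = pairing q a + s * b := by
    intro q s
    have h1 : (q, s) = (q, (0 : ℝ)) + s • ((0 : K → ℝ), (1 : ℝ)) := by simp
    have h2 := ha q
    simp only [ContinuousLinearMap.comp_apply, ContinuousLinearMap.inl_apply] at h2
    rw [h1, map_add, map_smul, h2, smul_eq_mul]
    simp [pairing, mul_comm, hb]
  rw [hφ'] at hu
  have hlt : ∀ q ∈ simplexSet K, pairing p a + r * b < pairing q a + f q * b := fun q hq =>
    hu.trans (by simpa [hφ'] using hφ (q, f q) ⟨hq, le_rfl⟩)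
  have hb0 : 0 < b := by nlinarith [hlt p hp]
  refine ⟨(fun _ => b⁻¹ * pairing p a + r) + (-b⁻¹) • a, fun q hq => ?_, ?_⟩
  · rw [pairing_add, pairing_const hq, pairing_smul]
    have h := mul_le_mul_of_nonneg_left (hlt q hq).le (inv_nonneg.2 hb0.le)
    have h1 : b⁻¹ * b = 1 := inv_mul_cancel₀ hb0.ne'
    linear_combination h + (f q - r) * h1
  · rw [pairing_add, pairing_const hp, pairing_smul]
    ring

lemma le_suppFn_single [DecidableEq K] {G : Set (K → ℝ)}
    (hb : ∀ p ∈ simplexSet K, BddAbove ((fun g => pairing p g) '' G)) {g : K → ℝ} (hg : g ∈ G)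
    (k : K) : g k ≤ suppFn G (Pi.single k 1) := by
  rw [← pairing_single k g]
  exact pairing_le_suppFn (hb _ (single_mem_simplexSet k)) hg

/-- Closed sets whose coordinates are bounded above have a closed Minkowski sum. -/
lemma isClosed_add_of_bddAbove {G H : Set (K → ℝ)} (hG : IsClosed G) (hH : IsClosed H)
    (hGb : BddAbove G) (hHb : BddAbove H) : IsClosed (G + H) := by
  obtain ⟨A, hA⟩ := hGb
  obtain ⟨B, hB⟩ := hHb
  refine IsSeqClosed.isClosed fun w m hw hm => ?_
  choose l hl t ht hlt using fun n => Set.mem_add.1 (hw n)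
  obtain ⟨C, hC⟩ := hm.bddBelow_range
  have hmem : ∀ n, l n ∈ Set.Icc (C - B) A := fun n => by
    refine ⟨?_, hA (hl n)⟩
    have h1 : C ≤ l n + t n := (hC ⟨n, rfl⟩).trans_eq (hlt n).symm
    exact sub_le_iff_le_add.2 (h1.trans (by gcongr; exact hB (ht n)))
  obtain ⟨x, -, ψ, hψ, hx⟩ := isCompact_Icc.tendsto_subseq hmem
  refine ⟨x, hG.mem_of_tendsto hx (Filter.Eventually.of_forall fun n => hl _), m - x, ?_,
    add_sub_cancel x m⟩
  refine hH.mem_of_tendsto ((hm.comp hψ.tendsto_atTop).sub hx)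
    (Filter.Eventually.of_forall fun n => ?_)
  simpa [← hlt] using ht (ψ n)

lemma IsCUAS.bddAbove {G : Set (K → ℝ)} (hG : IsCUAS G) : BddAbove G := by
  classical
  exact ⟨fun k => suppFn G (Pi.single k 1), fun g hg k => le_suppFn_single hG.2.2.2.2.1 hg k⟩

/-- The set of linear minorants, on the simplex, of a function `f`. -/
def linearMinorants (f : (K → ℝ) → ℝ) : Set (K → ℝ) :=
  {x | ∀ p ∈ simplexSet K, pairing p x ≤ f p}

variable [Nonempty K] {f : (K → ℝ) → ℝ}

lemma linearMinorants_nonempty (hf : ConvexOn ℝ (simplexSet K) f)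
    (hc : ContinuousOn f (simplexSet K)) : (linearMinorants f).Nonempty := by
  classical
  obtain ⟨x, hx, -⟩ := exists_pairing_eq_of_lt hf hc
    (single_mem_simplexSet (Classical.arbitrary K)) (sub_one_lt _)
  exact ⟨x, hx⟩

lemma suppFn_linearMinorants (hf : ConvexOn ℝ (simplexSet K) f)
    (hc : ContinuousOn f (simplexSet K)) {p : K → ℝ} (hp : p ∈ simplexSet K) :
    suppFn (linearMinorants f) p = f p := by
  refine le_antisymm (suppFn_le (linearMinorants_nonempty hf hc) fun g hg => hg p hp)
    (le_of_forall_lt fun r hr => ?_)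
  obtain ⟨s, hrs, hs⟩ := exists_between hr
  obtain ⟨x, hx, hxs⟩ := exists_pairing_eq_of_lt hf hc hp hs
  rw [← hxs] at hrs
  exact hrs.trans_le (pairing_le_suppFn ⟨f p, Set.forall_mem_image.2 fun g hg => hg p hp⟩ hx)

lemma isCUAS_linearMinorants (hf : ConvexOn ℝ (simplexSet K) f)
    (hc : ContinuousOn f (simplexSet K)) : IsCUAS (linearMinorants f) := by
  refine ⟨linearMinorants_nonempty hf hc, ?_, ?_, fun g hg v hv p hp => ?_,
    fun p hp => ⟨f p, Set.forall_mem_image.2 fun g hg => hg p hp⟩,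
    hc.congr fun p hp => suppFn_linearMinorants hf hc hp⟩
  · simp only [linearMinorants, Set.ofPred_forall]
    exact isClosed_iInter fun p => isClosed_iInter fun _ =>
      isClosed_le (continuous_pairing p) continuous_const
  · intro x hx y hy a b ha hb hab p hp
    rw [pairing_add, pairing_smul, pairing_smul]
    calc a * pairing p x + b * pairing p y ≤ a * f p + b * f p :=
          add_le_add (mul_le_mul_of_nonneg_left (hx p hp) ha)
            (mul_le_mul_of_nonneg_left (hy p hp) hb)
      _ = f p := by rw [← add_mul, hab, one_mul]
  · rw [pairing_add]
    linarith [hg p hp, pairing_nonpos hp hv]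

end SupportFunctions

theorem convex_difference_iff_minkowski_sum
    {K : Type} [Fintype K] [Nonempty K] (M L : Set (K → ℝ))
    (hM : IsCUAS M) (hL : IsCUAS L) :
    ConvexOn ℝ (simplexSet K) (fun p => suppFn M p - suppFn L p)
    ↔ ∃ T : Set (K → ℝ), IsCUAS T ∧ M = L + T := by
  have ⟨hMne, hMcl, hMcv, hMcomp, hMb, hMcont⟩ := hM
  have ⟨hLne, hLcl, hLcv, hLcomp, hLb, hLcont⟩ := hL
  constructor
  · intro hf
    have hc := hMcont.sub hLcont
    have hT := isCUAS_linearMinorants hf hc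
    refine ⟨_, hT, Set.Subset.antisymm (fun x hx => ?_) ?_⟩
    · refine mem_of_forall_pairing_le (hLne.add hT.1)
        (isClosed_add_of_bddAbove hLcl hT.2.1 hL.bddAbove hT.bddAbove) (hLcv.add hT.2.2.1) ?_
        fun p hp => ?_
      · rintro _ ⟨l, hl, t, ht, rfl⟩ v hv
        exact ⟨l, hl, t + v, hT.2.2.2.1 t ht v hv, (add_assoc l t v).symm⟩
      · rw [suppFn_add hLne hT.1 (hLb p hp) (hT.2.2.2.2.1 p hp), suppFn_linearMinorants hf hc hp,
          add_sub_cancel]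
        exact pairing_le_suppFn (hMb p hp) hx
    · rintro _ ⟨l, hl, t, ht, rfl⟩
      refine mem_of_forall_pairing_le hMne hMcl hMcv hMcomp fun p hp => ?_
      rw [pairing_add]
      linarith [ht p hp, pairing_le_suppFn (hLb p hp) hl]
  · rintro ⟨T, hT, rfl⟩
    refine (convexOn_suppFn hT.1 hT.2.2.2.2.1).congr fun p hp => ?_
    rw [suppFn_add hLne hT.1 (hLb p hp) (hT.2.2.2.2.1 p hp), add_sub_cancel_left]
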